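/- Let d ≥ 5, N ≥ 3, ν > 0, c > 0, and let r ∈ ℕ₀^{2N−1} and t ∈ [0,∞)^{2N−1} be such that for every index i either r_i ≥ 1 or t_i ≥ c. Then there is a constant L, depending only on d, ν and c, such that for every n and all x₂,…,x_{N−1} ∈ ℝ^d: Σ_{m ∈ L^{(N)}_r[0,n]} ∫_{ℝ^d} Φ^{(ν)}_{N,m,t}(x₁,…,x_{N−1}) dx₁ ≤ L Σ_{m' ∈ L^{(N−1)}_{r'}[0,n]} Φ^{(ν)}_{N−1,m',t'}(x₂,…,x_{N−1}), where r' = (r₃, r₁+r₄, r₂+r₅, r₆, …, r_{2N−1}) and t' = (t₃, t₁+t₄, t₂+t₅, t₆, …, t_{2N−1}) (both with 2N−3 components). -/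

import Mathlib

open MeasureTheory Filter Finset
open scoped Classical

noncomputable section

abbrev Ed (d : ℕ) := EuclideanSpace ℝ (Fin d)

/-- The centered Gaussian density `φ_t` on `ℝ^d` with covariance `t · Id`. -/
def gauss (d : ℕ) (t : ℝ) (x : Ed d) : ℝ :=
  (2 * Real.pi * t) ^ (-(d : ℝ) / 2) * Real.exp (-‖x‖ ^ 2 / (2 * t))

/-- Convolution of two functions on `ℝ^d`. -/
def convl (d : ℕ) (f g : Ed d → ℝ) (x : Ed d) : ℝ := ∫ y, f y * g (x - y)

/-- `γ^{(k)}(m) = ∫ |y|^{2k} Γ_m(y) dy`. -/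
def gammaMom {d : ℕ} (Γ : ℕ → Ed d → ℝ) (k m : ℕ) : ℝ := ∫ y, ‖y‖ ^ (2 * k) * Γ m y

/-- A rotationally invariant (radial) function on `ℝ^d`. -/
def Radial {d : ℕ} (f : Ed d → ℝ) : Prop := ∀ x y : Ed d, ‖x‖ = ‖y‖ → f x = f y

/-- A function vanishing at infinity. -/
def VanishAtInfty {d : ℕ} (f : Ed d → ℝ) : Prop := Tendsto f (cocompact (Ed d)) (nhds 0)

/-- Condition B1–B4 on the dominating sequence `Γ`. -/
structure CondB (d : ℕ) (Γ : ℕ → Ed d → ℝ) (χ : ℕ → ℕ → ℝ) (K1 K2 K3 : ℝ) : Prop where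
  pos : ∀ m, 1 ≤ m → ∀ x, 0 < Γ m x
  cont : ∀ m, 1 ≤ m → Continuous (Γ m)
  radial : ∀ m, 1 ≤ m → Radial (Γ m)
  vanish : ∀ m, 1 ≤ m → VanishAtInfty (Γ m)
  integrable : ∀ m, 1 ≤ m → ∀ k, k ≤ 2 → Integrable fun y => ‖y‖ ^ (2 * k) * Γ m y
  chi_pos : ∀ n s, 1 ≤ s → s ≤ n → 0 < χ n s
  chi_symm : ∀ n s, 1 ≤ s → s ≤ n → χ n s = χ n (n - s)
  chi_sum : ∀ n : ℕ, (∑ s ∈ Finset.Ico 1 n, (↑(min s (n - s)) : ℝ) * χ n s) ≤ K1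
  conv_le : ∀ m n, 1 ≤ m → 1 ≤ n → ∀ x, convl d (Γ m) (Γ n) x ≤ χ (m + n) m * Γ (m + n) x
  doubling : ∀ t s : ℕ, 1 ≤ t → t ≤ s → s ≤ 2 * t → ∀ x, Γ s x ≤ K2 * Γ (2 * t) x
  smoothing : ∀ (m : ℕ) (t : ℝ), 1 ≤ m → (m : ℝ) ≤ t → ∀ k, k ≤ 2 → ∀ x,
    (∫ y, gauss d t (x - y) * (‖y‖ ^ (2 * k) * Γ m y)) ≤
      K3 * gammaMom Γ k m * gauss d (t + (m : ℝ)) x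
  sum0 : Summable fun n : ℕ => (n : ℝ) * gammaMom Γ 0 n
  sum1 : Summable fun n : ℕ => gammaMom Γ 1 n
  sum2 : Summable fun n : ℕ => gammaMom Γ 2 n / (n : ℝ)

/-- `b_k = ∫ B_k`. -/
def bInt {d : ℕ} (B : ℕ → Ed d → ℝ) (k : ℕ) : ℝ := ∫ y, B k y

/-- The scalar `b̄_m` with `∫ x xᵀ B_m(x) dx = b̄_m I_d`. -/
def bbar {d : ℕ} (B : ℕ → Ed d → ℝ) (m : ℕ) : ℝ := (∫ y, ‖y‖ ^ 2 * B m y) / d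

/-- Regularity of the sequence `B`, dominated by `Γ`. -/
structure BSeq (d : ℕ) (B Γ : ℕ → Ed d → ℝ) : Prop where
  cont : ∀ m, 1 ≤ m → Continuous (B m)
  radial : ∀ m, 1 ≤ m → Radial (B m)
  vanish : ∀ m, 1 ≤ m → VanishAtInfty (B m)
  integrable : ∀ m, 1 ≤ m → Integrable (B m)
  integrable2 : ∀ m, 1 ≤ m → Integrable fun y => ‖y‖ ^ 2 * B m y
  dom : ∀ m, 1 ≤ m → ∀ x, |B m x| ≤ Γ m x

/-- The recursion for the norming sequence `c`. -/
def cSeq {d : ℕ} (B : ℕ → Ed d → ℝ) (lam : ℝ) (c : ℕ → ℝ) : Prop :=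
  c 0 = 1 ∧ ∀ n, 1 ≤ n →
    c n = c (n - 1) + lam * ∑ k ∈ Finset.Icc 1 n, c k * bInt B k * c (n - k)

/-- The basic convolution recursion for `C` (with `C_0 = δ_0`). -/
def CSeq (d : ℕ) (B : ℕ → Ed d → ℝ) (lam : ℝ) (c : ℕ → ℝ) (C : ℕ → Ed d → ℝ) : Prop :=
  (∀ x, C 1 x = gauss d 1 x + lam * (c 1 * B 1 x)) ∧
  ∀ n, 2 ≤ n → ∀ x, C n x = convl d (C (n - 1)) (gauss d 1) x +
    lam * ((∑ k ∈ Finset.Icc 1 (n - 1), c k * convl d (B k) (C (n - k)) x) + c n * B n x)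

/-- The drift parameter `δ`. -/
def deltaParam {d : ℕ} (B : ℕ → Ed d → ℝ) (lam μ : ℝ) (a : ℕ → ℝ) : ℝ :=
  (μ⁻¹ + lam * ∑' m : ℕ, a (m + 1) * bbar B (m + 1)) /
    (μ⁻¹ + lam * ∑' m : ℕ, ((m : ℝ) + 1) * a (m + 1) * bInt B (m + 1))

def zeta1 {d : ℕ} (Γ : ℕ → Ed d → ℝ) (n : ℕ) : ℝ :=
  1 + ∑ i ∈ Finset.range 3, ∑ m ∈ Finset.Icc 1 n, (m : ℝ) ^ (2 - i) * gammaMom Γ i m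

def zeta2 {d : ℕ} (Γ : ℕ → Ed d → ℝ) (n : ℕ) : ℝ :=
  ∑' m : ℕ, (gammaMom Γ 1 (n + m) + (↑(n + m) : ℝ) * gammaMom Γ 0 (n + m))

def zetaBar {d : ℕ} (Γ : ℕ → Ed d → ℝ) (n : ℕ) : ℝ :=
  (∑ j ∈ Finset.Icc 1 n, zeta1 Γ j) / (n : ℝ) ^ 2 + (∑ j ∈ Finset.Icc 1 n, zeta2 Γ j) / (n : ℝ)

/-- `ψ_n = φ_{nδ(1+ε)}`. -/
def psiFun (d : ℕ) (δv ε : ℝ) (n : ℕ) : Ed d → ℝ := gauss d ((n : ℝ) * δv * (1 + ε))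

/-- `f_n = Σ_{s=1}^{[n/2]} s (ψ_s * Γ_{n-s}) + ζ̄(n) ψ_n`. -/
def fFun (d : ℕ) (Γ : ℕ → Ed d → ℝ) (δv ε : ℝ) (n : ℕ) (x : Ed d) : ℝ :=
  (∑ s ∈ Finset.Icc 1 (n / 2), (s : ℝ) * convl d (psiFun d δv ε s) (Γ (n - s)) x) +
    zetaBar Γ n * psiFun d δv ε n x

/-- `κ(n) = Σ_{s=1}^{[n/2]} ψ_s * Γ_{n-s} + (ζ̄(n)/n) ψ_n`. -/
def kapFun (d : ℕ) (Γ : ℕ → Ed d → ℝ) (δv ε : ℝ) (n : ℕ) (x : Ed d) : ℝ :=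
  (∑ s ∈ Finset.Icc 1 (n / 2), convl d (psiFun d δv ε s) (Γ (n - s)) x) +
    zetaBar Γ n / n * psiFun d δv ε n x

/-- `Δ(k,j)`, with the convention `φ_0 = δ_0` (the `m = k` term is `B_m` itself). -/
def DeltaFun (d : ℕ) (B : ℕ → Ed d → ℝ) (lam μ δv : ℝ) (a : ℕ → ℝ) (k j : ℕ) (x : Ed d) : ℝ :=
  a j * gauss d ((k : ℝ) * δv) x - μ⁻¹ * a (j - 1) * gauss d (((k : ℝ) - 1) * δv + 1) x -
    lam * ∑ m ∈ Finset.Icc 1 j, a m * a (j - m) *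
      (if m = k then B m x else convl d (B m) (gauss d (((k : ℝ) - (m : ℝ)) * δv)) x)

/-! Weakly self-avoiding walk. -/

/-- `I_ρ`, the indicator of the ball of radius `ρ`. -/
def indBall (d : ℕ) (ρ : ℝ) (x : Ed d) : ℝ := if ‖x‖ ≤ ρ then 1 else 0

/-- `K_{λ,ρ}[a,b]`. -/
def Ksaw (d : ℕ) (lam ρ : ℝ) (a b : ℕ) (y : ℕ → Ed d) : ℝ :=
  ∏ p ∈ (Finset.Icc a b ×ˢ Finset.Icc a b).filter fun p => p.1 < p.2,
    (1 - lam * indBall d ρ (y p.2 - y p.1))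

/-- `Φ[a,b]`. -/
def PhiProd (d : ℕ) (a b : ℕ) (y : ℕ → Ed d) : ℝ :=
  ∏ i ∈ Finset.Icc (a + 1) b, gauss d 1 (y i - y (i - 1))

/-- Extend a finite vector `z : Fin L → ℝ^d` to indices `1,…,L` in `ℕ`. -/
def extPath (d L : ℕ) (z : Fin L → Ed d) (i : ℕ) : Ed d :=
  if h : 1 ≤ i ∧ i ≤ L then z ⟨i - 1, by omega⟩ else 0

/-- The path `0, x_1, …, x_{n-1}, x`. -/
def sawPath (d n : ℕ) (x : Ed d) (z : ℕ → Ed d) (j : ℕ) : Ed d :=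
  if j = 0 then 0 else if j = n then x else z j

/-- The connectivity function `C_n^{SAW}`. -/
def Csaw (d : ℕ) (lam ρ : ℝ) (n : ℕ) (x : Ed d) : ℝ :=
  ∫ z : Fin (n - 1) → Ed d,
    Ksaw d lam ρ 0 n (sawPath d n x (extPath d (n - 1) z)) *
      PhiProd d 0 n (sawPath d n x (extPath d (n - 1) z))

/-- `c_n^{SAW} = ∫ C_n^{SAW}`. -/
def csawInt (d : ℕ) (lam ρ : ℝ) (n : ℕ) : ℝ := ∫ x, Csaw d lam ρ n x

/-- Connected graphs on `[a,b]` (in the sense of the lace expansion). -/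
def IsConnGraph (a b : ℕ) (G : Finset (ℕ × ℕ)) : Prop :=
  (∀ p ∈ G, a ≤ p.1 ∧ p.1 < p.2 ∧ p.2 ≤ b) ∧
    (∃ p ∈ G, p.1 = a ∨ p.2 = a) ∧ (∃ p ∈ G, p.1 = b ∨ p.2 = b) ∧
    ∀ c, a < c → c < b → ∃ p ∈ G, p.1 < c ∧ c < p.2

/-- `J[a,b]`, the sum over connected graphs. -/
def Jsaw (d : ℕ) (lam ρ : ℝ) (a b : ℕ) (y : ℕ → Ed d) : ℝ :=
  ∑ G ∈ ((Finset.Icc a b ×ˢ Finset.Icc a b).powerset).filter (IsConnGraph a b),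
    ∏ p ∈ G, -(lam * indBall d ρ (y p.2 - y p.1))

/-- The lace functions `Π_n`. -/
def Pisaw (d : ℕ) (lam ρ : ℝ) (n : ℕ) (x : Ed d) : ℝ :=
  ∫ z : Fin (n - 1) → Ed d,
    Jsaw d lam ρ 0 n (sawPath d n x (extPath d (n - 1) z)) *
      PhiProd d 0 n (sawPath d n x (extPath d (n - 1) z))

/-- The error rates `r_n`. -/
def rseq (d n : ℕ) : ℝ :=
  if d = 5 then (n : ℝ) ^ (-(1 : ℝ) / 2)
  else if d = 6 then Real.log n / n
  else (n : ℝ)⁻¹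

/-- `Γ_n = K n^{-d/2} Σ_{k=1}^n k^{1-d/2} φ_{2k/5}`. -/
def GammaSAW (d : ℕ) (K : ℝ) (n : ℕ) (x : Ed d) : ℝ :=
  K * (n : ℝ) ^ (-(d : ℝ) / 2) *
    ∑ k ∈ Finset.Icc 1 n, (k : ℝ) ^ (1 - (d : ℝ) / 2) * gauss d (2 * k / 5) x

/-- `χ_n(s) = LK (n/(s(n-s)))^{d/2}`. -/
def chiSAW (d : ℕ) (LK : ℝ) (n s : ℕ) : ℝ :=
  LK * ((n : ℝ) / ((s : ℝ) * (↑(n - s) : ℝ))) ^ ((d : ℝ) / 2)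

/-! Laces. -/

/-- `β(j)`: index of the bond of the basic `N`-lace containing the vertex `j`. -/
def betaIdx (N j : ℕ) : ℕ :=
  if j = 0 then 1 else if j = 2 * N - 1 then N else if j % 2 = 0 then j / 2 else (j + 3) / 2

/-- `Φ^{(ν)}_{N,m,t}(x₁,…,x_{N-1})` (with `x 0 = 0` as convention on the argument). -/
def PhiLace (d N : ℕ) (ν : ℝ) (m : Fin (2 * N - 1) → ℕ) (t : Fin (2 * N - 1) → ℝ)
    (x : ℕ → Ed d) : ℝ :=
  ∏ i : Fin (2 * N - 1),
    gauss d (ν * m i + t i) (x (betaIdx N ((i : ℕ) + 1) - 1) - x (betaIdx N (i : ℕ) - 1))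

/-- `L^{(N)}_r[0,n]`: interdistance vectors summing to `n`, bounded below by `r`. -/
def laceFinset (len n : ℕ) (r : Fin len → ℕ) : Finset (Fin len → ℕ) :=
  (Fintype.piFinset fun _ => Finset.range (n + 1)).filter fun m =>
    (∑ i, m i) = n ∧ ∀ i, r i ≤ m i

/-- Extend a vector `Fin len → ℕ` to indices `1,…,len`. -/
def extVec (len : ℕ) (m : Fin len → ℕ) (i : ℕ) : ℕ :=
  if h : 1 ≤ i ∧ i ≤ len then m ⟨i - 1, by omega⟩ else 0

/-- The vertices of a lace diagram, collapsing steps with `m_i = 0` (`G_0 = δ_0`). -/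
def laceVertex (d N : ℕ) (m : ℕ → ℕ) (x : Ed d) (z : ℕ → Ed d) : ℕ → Ed d
  | 0 => 0
  | i + 1 =>
    if i + 1 = 2 * N - 1 then x
    else if m (i + 1) = 0 then laceVertex d N m x z i
    else z (i + 1)

/-- Lower endpoint `i̲` of the `i`-th bond of the basic `N`-lace. -/
def bLow (i : ℕ) : ℕ := if i = 1 then 0 else 2 * i - 3

/-- Upper endpoint `ī` of the `i`-th bond of the basic `N`-lace. -/
def bHigh (N i : ℕ) : ℕ := if i = N then 2 * N - 1 else 2 * i

/-- `Ξ_ℓ(G,ρ)(x)`; coordinates with `m_i = 0` are collapsed (the `δ_0` convention),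
and the corresponding unused integration variables are normalized away by a
standard Gaussian factor. -/
def XiLace (d N : ℕ) (G : ℕ → Ed d → ℝ) (ρ : ℝ) (m : Fin (2 * N - 1) → ℕ) (x : Ed d) : ℝ :=
  ∫ z : Fin (2 * N - 2) → Ed d,
    (∏ i ∈ Finset.Icc 1 (2 * N - 1),
      if extVec (2 * N - 1) m i = 0 then gauss d 1 (extPath d (2 * N - 2) z i)
      else
        G (extVec (2 * N - 1) m i)
          (laceVertex d N (extVec (2 * N - 1) m) x (extPath d (2 * N - 2) z) i -
            laceVertex d N (extVec (2 * N - 1) m) x (extPath d (2 * N - 2) z) (i - 1))) *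
    ∏ i ∈ Finset.Icc 1 N,
      indBall d ρ
        (laceVertex d N (extVec (2 * N - 1) m) x (extPath d (2 * N - 2) z) (bHigh N i) -
          laceVertex d N (extVec (2 * N - 1) m) x (extPath d (2 * N - 2) z) (bLow i))

/-- The natural restriction vector `r⁰` for `N`-laces (`0`-indexed). -/
def r0vec (N : ℕ) (j : Fin (2 * N - 1)) : ℕ :=
  if (j : ℕ) % 2 = 1 ∨ (j : ℕ) = 0 ∨ (j : ℕ) = 2 * N - 2 then 1 else 0

/-- `ξ_n^{(N)}(G,ρ) = Σ_{ℓ ∈ L^{(N)}[0,n]} Ξ_ℓ(G,ρ)`. -/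
def xiLace (d N : ℕ) (G : ℕ → Ed d → ℝ) (ρ : ℝ) (n : ℕ) (x : Ed d) : ℝ :=
  ∑ m ∈ laceFinset (2 * N - 1) n (r0vec N), XiLace d N G ρ m x

/-- `Γ_n = n^{-a} φ_{n/2}`. -/
def GammaPoly (d : ℕ) (a : ℝ) (n : ℕ) (x : Ed d) : ℝ := (n : ℝ) ^ (-a) * gauss d ((n : ℝ) / 2) x

theorem gauss_nonneg (d : ℕ) {t : ℝ} (ht : 0 ≤ t) (x : Ed d) : 0 ≤ gauss d t x := by
  unfold gauss
  positivity

theorem gauss_neg (d : ℕ) (t : ℝ) (x : Ed d) : gauss d t (-x) = gauss d t x := by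
  simp [gauss]

theorem gauss_sub_comm (d : ℕ) (t : ℝ) (x y : Ed d) : gauss d t (x - y) = gauss d t (y - x) := by
  rw [← gauss_neg, neg_sub]

theorem gauss_le (d : ℕ) {t : ℝ} (ht : 0 < t) (x : Ed d) :
    gauss d t x ≤ (2 * Real.pi * t) ^ (-(d : ℝ) / 2) := by
  unfold gauss
  refine mul_le_of_le_one_right (by positivity) (Real.exp_le_one_iff.2 ?_)
  exact div_nonpos_of_nonpos_of_nonneg (by nlinarith [sq_nonneg ‖x‖]) (by positivity)

theorem integral_gauss (d : ℕ) {t : ℝ} (ht : 0 < t) : ∫ x : Ed d, gauss d t x = 1 := by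
  have h := GaussianFourier.integral_rexp_neg_mul_sq_norm (V := Ed d) (b := (2 * t)⁻¹)
    (by positivity)
  have hpi := Real.pi_pos
  have he : ∀ x : Ed d, gauss d t x =
      (2 * Real.pi * t) ^ (-(d : ℝ) / 2) * Real.exp (-(2 * t)⁻¹ * ‖x‖ ^ 2) := by
    intro x
    unfold gauss
    congr 2
    field_simp
  simp_rw [he]
  rw [integral_const_mul, h, finrank_euclideanSpace_fin,
    show Real.pi / (2 * t)⁻¹ = 2 * Real.pi * t by field_simp, ← Real.rpow_add (by positivity),
    neg_div, neg_add_cancel, Real.rpow_zero]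

theorem integrable_gauss (d : ℕ) {t : ℝ} (ht : 0 < t) : Integrable (gauss d t) := by
  apply Integrable.of_integral_ne_zero
  rw [integral_gauss d ht]
  exact one_ne_zero

/-- Product of two Gaussian densities, completed to a square in the first variable. -/
theorem gauss_mul_gauss_sub (d : ℕ) {a b : ℝ} (ha : 0 < a) (hb : 0 < b) (z u : Ed d) :
    gauss d a z * gauss d b (z - u) =
      gauss d (a + b) u * gauss d (a * b / (a + b)) (z - (a / (a + b)) • u) := by
  have hpi := Real.pi_pos
  unfold gauss
  rw [mul_mul_mul_comm, mul_mul_mul_comm ((2 * Real.pi * (a + b)) ^ _), ← Real.exp_add,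
    ← Real.exp_add, ← Real.mul_rpow (by positivity) (by positivity),
    ← Real.mul_rpow (by positivity) (by positivity)]
  congr 2
  · field_simp
  · rw [norm_sub_sq_real, norm_sub_sq_real, norm_smul, inner_smul_right, mul_pow,
      Real.norm_of_nonneg (by positivity)]
    field_simp
    ring

theorem integral_gauss_mul_gauss_le (d : ℕ) {A B : ℝ} (hA : 0 < A) (hB : 0 < B) (p q : Ed d) :
    ∫ z, gauss d A (z - p) * gauss d B (z - q) ≤ (2 * Real.pi * A) ^ (-(d : ℝ) / 2) := by
  have hint : Integrable fun z : Ed d => gauss d B (z - q) :=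
    (integrable_gauss d hB).comp_sub_right q
  calc ∫ z, gauss d A (z - p) * gauss d B (z - q)
      ≤ ∫ z, (2 * Real.pi * A) ^ (-(d : ℝ) / 2) * gauss d B (z - q) := by
        refine integral_mono_of_nonneg (ae_of_all _ fun z => ?_) (hint.const_mul _)
          (ae_of_all _ fun z => ?_)
        · exact mul_nonneg (gauss_nonneg d hA.le _) (gauss_nonneg d hB.le _)
        · exact mul_le_mul_of_nonneg_right (gauss_le d hA _) (gauss_nonneg d hB.le _)
    _ = (2 * Real.pi * A) ^ (-(d : ℝ) / 2) := by
        rw [integral_const_mul, integral_sub_right_eq_self (gauss d B) q, integral_gauss d hB,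
          mul_one]

theorem integral_gauss_mul_gauss_le_mul (d : ℕ) {A B : ℝ} (hA : 0 < A) (hB : 0 < B) (p q : Ed d) :
    ∫ z, gauss d A (z - p) * gauss d B (z - q) ≤
      (2 * Real.pi * A) ^ (-(d : ℝ) / 4) * (2 * Real.pi * B) ^ (-(d : ℝ) / 4) := by
  have hpi := Real.pi_pos
  have hsq : ∀ C : ℝ, 0 < C →
      (2 * Real.pi * C) ^ (-(d : ℝ) / 2) = ((2 * Real.pi * C) ^ (-(d : ℝ) / 4)) ^ 2 := by
    intro C hC
    rw [← Real.rpow_natCast, ← Real.rpow_mul (by positivity)]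
    congr 1
    push_cast
    ring
  have h1 := integral_gauss_mul_gauss_le d hA hB p q
  have h2 := integral_gauss_mul_gauss_le d hB hA q p
  simp_rw [mul_comm (gauss d B _)] at h2
  rw [hsq A hA] at h1
  rw [hsq B hB] at h2
  have hX : 0 ≤ (2 * Real.pi * A) ^ (-(d : ℝ) / 4) := by positivity
  have hY : 0 ≤ (2 * Real.pi * B) ^ (-(d : ℝ) / 4) := by positivity
  rcases le_total ((2 * Real.pi * A) ^ (-(d : ℝ) / 4))
    ((2 * Real.pi * B) ^ (-(d : ℝ) / 4)) with h | h
  · nlinarith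
  · nlinarith

/-- Integrating out the vertex shared by four Gaussian lines. -/
theorem integral_four_gauss_le (d : ℕ) {a b e f : ℝ} (ha : 0 < a) (hb : 0 < b) (he : 0 < e)
    (hf : 0 < f) (u v : Ed d) :
    ∫ z, gauss d a z * gauss d b z * gauss d e (z - u) * gauss d f (z - v) ≤
      gauss d (a + e) u * gauss d (b + f) v *
        ((2 * Real.pi * (a * e / (a + e))) ^ (-(d : ℝ) / 4) *
          (2 * Real.pi * (b * f / (b + f))) ^ (-(d : ℝ) / 4)) := by
  have key : ∀ z, gauss d a z * gauss d b z * gauss d e (z - u) * gauss d f (z - v) =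
      gauss d (a + e) u * gauss d (b + f) v *
        (gauss d (a * e / (a + e)) (z - (a / (a + e)) • u) *
          gauss d (b * f / (b + f)) (z - (b / (b + f)) • v)) := by
    intro z
    linear_combination (gauss d b z * gauss d f (z - v)) * gauss_mul_gauss_sub d ha he z u +
      (gauss d (a + e) u * gauss d (a * e / (a + e)) (z - (a / (a + e)) • u)) *
        gauss_mul_gauss_sub d hb hf z v
  simp_rw [key]
  rw [integral_const_mul]
  exact mul_le_mul_of_nonneg_left
    (integral_gauss_mul_gauss_le_mul d (by positivity) (by positivity) _ _)
    (mul_nonneg (gauss_nonneg d (by positivity) _) (gauss_nonneg d (by positivity) _))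

/-- A time parameter `ν m + τ` with `m ≥ ρ` and (`ρ ≥ 1` or `τ ≥ c`) grows at least linearly
in `1 + m`. -/
theorem mul_one_add_le_time {ν c τ : ℝ} {ρ m : ℕ} (hν : 0 < ν) (hτ : 0 ≤ τ)
    (h : 1 ≤ ρ ∨ c ≤ τ) (hm : ρ ≤ m) : min ν c / 2 * (1 + m) ≤ ν * m + τ := by
  have h1 := min_le_left ν c
  have h2 := min_le_right ν c
  rcases Nat.eq_zero_or_pos m with rfl | hpos
  · have : c ≤ τ := h.resolve_left (by omega)
    push_cast
    linarith
  · have : (1 : ℝ) ≤ m := by exact_mod_cast hpos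
    nlinarith

theorem rpow_harmonic_le {s κ a e : ℝ} {i j : ℕ} (hs : 0 ≤ s) (hκ : 0 < κ)
    (ha : κ * (1 + i) ≤ a) (he : κ * (1 + j) ≤ e) :
    (2 * Real.pi * (a * e / (a + e))) ^ (-s) ≤
      (Real.pi * κ) ^ (-s) * ((1 + i : ℝ) ^ (-s) + (1 + j : ℝ) ^ (-s)) := by
  have hpi := Real.pi_pos
  have ha0 : 0 < a := lt_of_lt_of_le (by positivity) ha
  have he0 : 0 < e := lt_of_lt_of_le (by positivity) he
  have hmono : ∀ k : ℕ, κ * (1 + k) ≤ 2 * (a * e / (a + e)) →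
      (2 * Real.pi * (a * e / (a + e))) ^ (-s) ≤ (Real.pi * κ) ^ (-s) * (1 + k : ℝ) ^ (-s) := by
    intro k hk
    rw [← Real.mul_rpow (by positivity) (by positivity)]
    refine Real.rpow_le_rpow_of_nonpos (by positivity) ?_ (by linarith)
    nlinarith
  rcases le_total a e with h | h
  · refine (hmono i (ha.trans ?_)).trans (mul_le_mul_of_nonneg_left ?_ (by positivity))
    · rw [← mul_div_assoc, le_div_iff₀ (by positivity)]
      nlinarith
    · exact le_add_of_nonneg_right (by positivity)
  · refine (hmono j (he.trans ?_)).trans (mul_le_mul_of_nonneg_left ?_ (by positivity))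
    · rw [← mul_div_assoc, le_div_iff₀ (by positivity)]
      nlinarith
    · exact le_add_of_nonneg_left (by positivity)

theorem summable_one_add_rpow {s : ℝ} (hs : 1 < s) :
    Summable fun i : ℕ => (1 + i : ℝ) ^ (-s) := by
  have h := (summable_nat_add_iff 1).2 (Real.summable_nat_rpow.2 (by linarith : -s < -1))
  simpa [add_comm] using h

theorem sum_range_add_reflect_le {g : ℕ → ℝ} (hg : Summable g) (h0 : ∀ i, 0 ≤ g i) (p : ℕ) :
    ∑ i ∈ range (p + 1), (g i + g (p - i)) ≤ 2 * ∑' i, g i := by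
  have h := Finset.sum_range_reflect g (p + 1)
  simp only [Nat.add_sub_cancel] at h
  rw [sum_add_distrib, h]
  linarith [hg.sum_le_tsum (range (p + 1)) fun i _ => h0 i]

theorem fin_prod_split_five {M : Type*} [CommMonoid M] {k l : ℕ} (h : k = l + 5) (f : Fin k → M) :
    ∏ i, f i = f ⟨0, by omega⟩ * f ⟨1, by omega⟩ * f ⟨2, by omega⟩ * f ⟨3, by omega⟩ *
      f ⟨4, by omega⟩ * ∏ i : Fin l, f ⟨i + 5, by omega⟩ := by
  subst h
  simp only [Fin.prod_univ_succ, mul_assoc]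
  rfl

theorem fin_prod_split_three {M : Type*} [CommMonoid M] {k l : ℕ} (h : k = l + 3) (f : Fin k → M) :
    ∏ i, f i = f ⟨0, by omega⟩ * f ⟨1, by omega⟩ * f ⟨2, by omega⟩ *
      ∏ i : Fin l, f ⟨i + 3, by omega⟩ := by
  subst h
  simp only [Fin.prod_univ_succ, mul_assoc]
  rfl

theorem fin_sum_split_five {k l : ℕ} (h : k = l + 5) (f : Fin k → ℕ) :
    ∑ i, f i = f ⟨0, by omega⟩ + f ⟨1, by omega⟩ + f ⟨2, by omega⟩ + f ⟨3, by omega⟩ +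
      f ⟨4, by omega⟩ + ∑ i : Fin l, f ⟨i + 5, by omega⟩ :=
  fin_prod_split_five (M := Multiplicative ℕ) h f

theorem fin_sum_split_three {k l : ℕ} (h : k = l + 3) (f : Fin k → ℕ) :
    ∑ i, f i = f ⟨0, by omega⟩ + f ⟨1, by omega⟩ + f ⟨2, by omega⟩ +
      ∑ i : Fin l, f ⟨i + 3, by omega⟩ :=
  fin_prod_split_three (M := Multiplicative ℕ) h f

/-- The map `(v₁,…,v_{2N-1}) ↦ (v₃, v₁ + v₄, v₂ + v₅, v₆, …, v_{2N-1})`. -/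
def collapseVec {α : Type*} [Add α] {N : ℕ} (hN : 3 ≤ N) (v : Fin (2 * N - 1) → α) :
    Fin (2 * (N - 1) - 1) → α := fun j =>
  if (j : ℕ) = 0 then v ⟨2, by omega⟩
  else if (j : ℕ) = 1 then v ⟨0, by omega⟩ + v ⟨3, by omega⟩
  else if (j : ℕ) = 2 then v ⟨1, by omega⟩ + v ⟨4, by omega⟩
  else v ⟨(j : ℕ) + 2, by have := j.isLt; omega⟩

theorem mem_laceFinset {len n : ℕ} {r m : Fin len → ℕ} :
    m ∈ laceFinset len n r ↔ ∑ i, m i = n ∧ ∀ i, r i ≤ m i := by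
  unfold laceFinset
  simp only [mem_filter, Fintype.mem_piFinset, mem_range, and_iff_right_iff_imp]
  rintro ⟨h, -⟩ i
  have := single_le_sum (f := m) (fun j _ => Nat.zero_le _) (mem_univ i)
  omega

theorem collapseVec_mem_laceFinset {N n : ℕ} (hN : 3 ≤ N) {r m : Fin (2 * N - 1) → ℕ}
    (hm : m ∈ laceFinset (2 * N - 1) n r) :
    collapseVec hN m ∈ laceFinset (2 * (N - 1) - 1) n (collapseVec hN r) := by
  rw [mem_laceFinset] at hm ⊢
  obtain ⟨hs, hr⟩ := hm
  refine ⟨?_, fun j => ?_⟩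
  · rw [fin_sum_split_five (l := 2 * N - 6) (by omega)] at hs
    rw [fin_sum_split_three (l := 2 * N - 6) (by omega), ← hs]
    simp [collapseVec]
    omega
  · unfold collapseVec
    split_ifs
    exacts [hr _, add_le_add (hr _) (hr _), add_le_add (hr _) (hr _), hr _]

/-- The lines of an `N`-lace diagram not touching `x₁` are those of the collapsed diagram. -/
theorem PhiLace_update_eq (d : ℕ) {N : ℕ} (hN : 3 ≤ N) (ν : ℝ) (m : Fin (2 * N - 1) → ℕ)
    (t : Fin (2 * N - 1) → ℝ) (x : ℕ → Ed d) (hx : x 0 = 0) (z : Ed d) :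
    PhiLace d N ν m t (Function.update x 1 z) =
      (gauss d (ν * m ⟨2, by omega⟩ + t ⟨2, by omega⟩) (x 2) *
        ∏ i : Fin (2 * N - 6), gauss d (ν * m ⟨i + 5, by omega⟩ + t ⟨i + 5, by omega⟩)
          (x (betaIdx N (i + 6) - 1) - x (betaIdx N (i + 5) - 1))) *
      (gauss d (ν * m ⟨0, by omega⟩ + t ⟨0, by omega⟩) z *
        gauss d (ν * m ⟨1, by omega⟩ + t ⟨1, by omega⟩) z *
        gauss d (ν * m ⟨3, by omega⟩ + t ⟨3, by omega⟩) (z - x 2) *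
        gauss d (ν * m ⟨4, by omega⟩ + t ⟨4, by omega⟩) (z - x (betaIdx N 5 - 1))) := by
  have b0 : betaIdx N 0 - 1 = 0 := by simp [betaIdx]
  have b1 : betaIdx N 1 - 1 = 1 := by unfold betaIdx; split_ifs <;> omega
  have b2 : betaIdx N 2 - 1 = 0 := by unfold betaIdx; split_ifs <;> omega
  have b3 : betaIdx N 3 - 1 = 2 := by unfold betaIdx; split_ifs <;> omega
  have b4 : betaIdx N 4 - 1 = 1 := by unfold betaIdx; split_ifs <;> omega
  have b5 : ∀ j, betaIdx N (j + 5) - 1 ≠ 1 := by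
    intro j; unfold betaIdx; split_ifs <;> omega
  have b5' := b5 0
  rw [PhiLace, fin_prod_split_five (l := 2 * N - 6) (by omega)]
  simp only [zero_add] at b5'
  simp [b0, b1, b2, b3, b4, b5', b5, Function.update_of_ne, hx, gauss_neg, add_assoc]
  rw [gauss_sub_comm d _ _ z]
  ring

theorem PhiLace_collapse_eq (d : ℕ) {N : ℕ} (hN : 3 ≤ N) (ν : ℝ) (m : Fin (2 * N - 1) → ℕ)
    (t : Fin (2 * N - 1) → ℝ) (x : ℕ → Ed d) :
    PhiLace d (N - 1) ν (collapseVec hN m) (collapseVec hN t)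
        (fun j => if j = 0 then 0 else x (j + 1)) =
      (gauss d (ν * m ⟨2, by omega⟩ + t ⟨2, by omega⟩) (x 2) *
        ∏ i : Fin (2 * N - 6), gauss d (ν * m ⟨i + 5, by omega⟩ + t ⟨i + 5, by omega⟩)
          (x (betaIdx N (i + 6) - 1) - x (betaIdx N (i + 5) - 1))) *
      (gauss d ((ν * m ⟨0, by omega⟩ + t ⟨0, by omega⟩) +
          (ν * m ⟨3, by omega⟩ + t ⟨3, by omega⟩)) (x 2) *
        gauss d ((ν * m ⟨1, by omega⟩ + t ⟨1, by omega⟩) +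
          (ν * m ⟨4, by omega⟩ + t ⟨4, by omega⟩)) (x (betaIdx N 5 - 1))) := by
  have b0 : betaIdx (N - 1) 0 - 1 = 0 := by simp [betaIdx]
  have b1 : betaIdx (N - 1) 1 - 1 = 1 := by unfold betaIdx; split_ifs <;> omega
  have b2 : betaIdx (N - 1) 2 - 1 = 0 := by unfold betaIdx; split_ifs <;> omega
  have b3 : ∀ j, (if betaIdx (N - 1) (j + 3) - 1 = 0 then 0
      else x (betaIdx (N - 1) (j + 3) - 1 + 1)) = x (betaIdx N (j + 5) - 1) := by
    intro j
    have h1 : 2 ≤ betaIdx (N - 1) (j + 3) := by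
      unfold betaIdx
      rw [if_neg (by omega)]
      split_ifs <;> omega
    have h2 : betaIdx (N - 1) (j + 3) - 1 + 1 = betaIdx N (j + 5) - 1 := by
      unfold betaIdx; split_ifs <;> omega
    rw [if_neg (by omega), h2]
  have b3' := b3 0
  rw [zero_add, zero_add] at b3'
  rw [PhiLace, fin_prod_split_three (l := 2 * N - 6) (by omega)]
  simp [collapseVec, b0, b1, b2, b3', b3, gauss_neg, add_assoc]
  rw [show ∀ a b e f : ℝ, ν * (a + b) + (e + f) = ν * a + (e + (ν * b + f)) by intros; ring,
    show ∀ a b e f : ℝ, ν * (a + b) + (e + f) = ν * a + (e + (ν * b + f)) by intros; ring]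
  ring

theorem PhiLace_nonneg (d N : ℕ) {ν : ℝ} (hν : 0 ≤ ν) (m : Fin (2 * N - 1) → ℕ)
    {t : Fin (2 * N - 1) → ℝ} (ht : ∀ i, 0 ≤ t i) (x : ℕ → Ed d) : 0 ≤ PhiLace d N ν m t x :=
  prod_nonneg fun i _ => gauss_nonneg d (add_nonneg (by positivity) (ht i)) _

theorem integral_PhiLace_le {d N : ℕ} (hN : 3 ≤ N) {ν c : ℝ} (hν : 0 < ν) (hc : 0 < c)
    {r : Fin (2 * N - 1) → ℕ} {t : Fin (2 * N - 1) → ℝ} (ht : ∀ i, 0 ≤ t i)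
    (hrt : ∀ i, 1 ≤ r i ∨ c ≤ t i) {m : Fin (2 * N - 1) → ℕ} (hm : ∀ i, r i ≤ m i)
    {x : ℕ → Ed d} (hx : x 0 = 0) :
    ∫ z : Ed d, PhiLace d N ν m t (Function.update x 1 z) ≤
      PhiLace d (N - 1) ν (collapseVec hN m) (collapseVec hN t)
          (fun j => if j = 0 then 0 else x (j + 1)) *
        (((Real.pi * (min ν c / 2)) ^ (-((d : ℝ) / 4)) *
            ((1 + m ⟨0, by omega⟩ : ℝ) ^ (-((d : ℝ) / 4)) +
              (1 + m ⟨3, by omega⟩ : ℝ) ^ (-((d : ℝ) / 4)))) *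
          ((Real.pi * (min ν c / 2)) ^ (-((d : ℝ) / 4)) *
            ((1 + m ⟨1, by omega⟩ : ℝ) ^ (-((d : ℝ) / 4)) +
              (1 + m ⟨4, by omega⟩ : ℝ) ^ (-((d : ℝ) / 4))))) := by
  have hpi := Real.pi_pos
  have hκ : 0 < min ν c / 2 := half_pos (lt_min hν hc)
  have hlow : ∀ i, min ν c / 2 * (1 + m i) ≤ ν * m i + t i := fun i =>
    mul_one_add_le_time hν (ht i) (hrt i) (hm i)
  have hpos : ∀ i, 0 < ν * m i + t i := fun i => lt_of_lt_of_le (by positivity) (hlow i)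
  simp_rw [PhiLace_update_eq d hN ν m t x hx]
  rw [integral_const_mul, PhiLace_collapse_eq, mul_assoc (_ * ∏ _, _)]
  refine mul_le_mul_of_nonneg_left ?_ (mul_nonneg (gauss_nonneg d (hpos _).le _)
    (prod_nonneg fun i _ => gauss_nonneg d (hpos _).le _))
  refine (integral_four_gauss_le d (hpos _) (hpos _) (hpos _) (hpos _) _ _).trans ?_
  refine mul_le_mul_of_nonneg_left ?_ (mul_nonneg
    (gauss_nonneg d (add_pos (hpos _) (hpos _)).le _)
    (gauss_nonneg d (add_pos (hpos _) (hpos _)).le _))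
  have hharm : ∀ i j, (2 * Real.pi * ((ν * m i + t i) * (ν * m j + t j) /
      ((ν * m i + t i) + (ν * m j + t j)))) ^ (-(d : ℝ) / 4) ≤
      (Real.pi * (min ν c / 2)) ^ (-((d : ℝ) / 4)) *
        ((1 + m i : ℝ) ^ (-((d : ℝ) / 4)) + (1 + m j : ℝ) ^ (-((d : ℝ) / 4))) := by
    intro i j
    rw [neg_div]
    exact rpow_harmonic_le (by positivity) hκ (hlow i) (hlow j)
  refine mul_le_mul (hharm _ _) (hharm _ _) ?_ (by positivity)
  have h1 := hpos ⟨1, by omega⟩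
  have h4 := hpos ⟨4, by omega⟩
  positivity

/-- A vector in a fibre of the collapsing map is determined by its first two entries. -/
theorem collapseVec_injOn {N : ℕ} (hN : 3 ≤ N) (m' : Fin (2 * (N - 1) - 1) → ℕ) :
    Set.InjOn (fun m : Fin (2 * N - 1) → ℕ => (m ⟨0, by omega⟩, m ⟨1, by omega⟩))
      {m | collapseVec hN m = m'} := by
  rintro a ha b hb hab
  simp only [Prod.mk.injEq] at hab
  obtain ⟨h0, h1⟩ := hab
  have hj : ∀ j, collapseVec hN a j = collapseVec hN b j := fun j => by
    exact congrFun (Eq.trans ha (Eq.symm hb)) j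
  have j0 := hj ⟨0, by omega⟩
  have j1 := hj ⟨1, by omega⟩
  have j2 := hj ⟨2, by omega⟩
  simp [collapseVec] at j0 j1 j2
  funext ⟨i, hi⟩
  by_cases h : i < 5
  · interval_cases i <;> omega
  · have := hj ⟨i - 2, by omega⟩
    simp only [collapseVec] at this
    rw [if_neg (by omega), if_neg (by omega), if_neg (by omega), if_neg (by omega),
      if_neg (by omega), if_neg (by omega)] at this
    simpa only [show i - 2 + 2 = i by omega] using this

theorem sum_fiber_le {N : ℕ} (hN : 3 ≤ N) {g : ℕ → ℝ} (hg : Summable g) (h0 : ∀ i, 0 ≤ g i)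
    (S : Finset (Fin (2 * N - 1) → ℕ)) (m' : Fin (2 * (N - 1) - 1) → ℕ) :
    ∑ m ∈ S with collapseVec hN m = m',
        (g (m ⟨0, by omega⟩) + g (m ⟨3, by omega⟩)) *
          (g (m ⟨1, by omega⟩) + g (m ⟨4, by omega⟩)) ≤ (2 * ∑' i, g i) ^ 2 := by
  set p := m' ⟨1, by omega⟩
  set q := m' ⟨2, by omega⟩
  have hfib : ∀ m : Fin (2 * N - 1) → ℕ, collapseVec hN m = m' →
      m ⟨0, by omega⟩ + m ⟨3, by omega⟩ = p ∧ m ⟨1, by omega⟩ + m ⟨4, by omega⟩ = q := by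
    rintro m rfl
    simp [p, q, collapseVec]
  let F : ℕ × ℕ → ℝ := fun k => (g k.1 + g (p - k.1)) * (g k.2 + g (q - k.2))
  have hF : ∀ k, 0 ≤ F k := fun k =>
    mul_nonneg (add_nonneg (h0 _) (h0 _)) (add_nonneg (h0 _) (h0 _))
  calc _ = ∑ m ∈ S with collapseVec hN m = m', F (m ⟨0, by omega⟩, m ⟨1, by omega⟩) := by
        refine sum_congr rfl fun m hm => ?_
        obtain ⟨hp, hq⟩ := hfib m (mem_filter.1 hm).2
        simp only [F, ← hp, ← hq, Nat.add_sub_cancel_left]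
    _ = ∑ k ∈ (S.filter fun m => collapseVec hN m = m').image
          (fun m => (m ⟨0, by omega⟩, m ⟨1, by omega⟩)), F k := by
        rw [sum_image]
        exact (collapseVec_injOn hN m').mono fun m hm => (mem_filter.1 hm).2
    _ ≤ ∑ k ∈ range (p + 1) ×ˢ range (q + 1), F k := by
        refine sum_le_sum_of_subset_of_nonneg ?_ fun k _ _ => hF k
        intro k hk
        obtain ⟨m, hm, rfl⟩ := mem_image.1 hk
        obtain ⟨hp, hq⟩ := hfib m (mem_filter.1 hm).2
        simp only [mem_product, mem_range]
        omega
    _ = (∑ i ∈ range (p + 1), (g i + g (p - i))) * ∑ j ∈ range (q + 1), (g j + g (q - j)) := by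
        rw [sum_product, sum_mul_sum]
    _ ≤ (2 * ∑' i, g i) ^ 2 := by
        rw [sq]
        exact mul_le_mul (sum_range_add_reflect_le hg h0 p) (sum_range_add_reflect_le hg h0 q)
          (sum_nonneg fun i _ => add_nonneg (h0 _) (h0 _))
          (mul_nonneg zero_le_two (tsum_nonneg h0))

/-- The collapsing mechanism: integrating out `x₁` reduces an `N`-lace diagram
to an `(N-1)`-lace diagram. -/
theorem lace_collapse (d : ℕ) (hd : 5 ≤ d) (ν c : ℝ) (hν : 0 < ν) (hc : 0 < c) :
    ∃ L > (0 : ℝ), ∀ N : ℕ, (hN : 3 ≤ N) →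
      ∀ (r : Fin (2 * N - 1) → ℕ) (t : Fin (2 * N - 1) → ℝ),
        (∀ i, 0 ≤ t i) → (∀ i, 1 ≤ r i ∨ c ≤ t i) →
        ∀ n : ℕ, ∀ x : ℕ → Ed d, x 0 = 0 →
          (∑ m ∈ laceFinset (2 * N - 1) n r,
              ∫ z : Ed d, PhiLace d N ν m t (Function.update x 1 z)) ≤
            L * ∑ m' ∈ laceFinset (2 * (N - 1) - 1) n (fun j =>
                if (j : ℕ) = 0 then r ⟨2, by omega⟩
                else if (j : ℕ) = 1 then r ⟨0, by omega⟩ + r ⟨3, by omega⟩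
                else if (j : ℕ) = 2 then r ⟨1, by omega⟩ + r ⟨4, by omega⟩
                else r ⟨(j : ℕ) + 2, by have := j.isLt; omega⟩),
              PhiLace d (N - 1) ν m' (fun j =>
                if (j : ℕ) = 0 then t ⟨2, by omega⟩
                else if (j : ℕ) = 1 then t ⟨0, by omega⟩ + t ⟨3, by omega⟩
                else if (j : ℕ) = 2 then t ⟨1, by omega⟩ + t ⟨4, by omega⟩
                else t ⟨(j : ℕ) + 2, by have := j.isLt; omega⟩)
                (fun j => if j = 0 then 0 else x (j + 1)) := by
  have hd' : (1 : ℝ) < (d : ℝ) / 4 := by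
    have : (5 : ℝ) ≤ d := by exact_mod_cast hd
    linarith
  have hpi := Real.pi_pos
  have hκ : 0 < min ν c / 2 := half_pos (lt_min hν hc)
  set K : ℝ := (Real.pi * (min ν c / 2)) ^ (-((d : ℝ) / 4)) with hK
  have hK0 : 0 < K := by positivity
  let g : ℕ → ℝ := fun i => (1 + i : ℝ) ^ (-((d : ℝ) / 4))
  have hg : Summable g := summable_one_add_rpow hd'
  have hg0 : ∀ i, 0 < g i := fun i => by positivity
  have hS : 0 < ∑' i, g i := hg.tsum_pos (fun i => (hg0 i).le) 0 (hg0 0)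
  refine ⟨K ^ 2 * (2 * ∑' i, g i) ^ 2, by positivity, ?_⟩
  intro N hN r t ht hrt n x hx
  have ht' : ∀ j, 0 ≤ collapseVec hN t j := by
    intro j
    unfold collapseVec
    split_ifs
    exacts [ht _, add_nonneg (ht _) (ht _), add_nonneg (ht _) (ht _), ht _]
  change _ ≤ _ * ∑ m' ∈ laceFinset (2 * (N - 1) - 1) n (collapseVec hN r),
    PhiLace d (N - 1) ν m' (collapseVec hN t) (fun j => if j = 0 then 0 else x (j + 1))
  rw [← sum_fiberwise_of_maps_to fun m hm => collapseVec_mem_laceFinset hN hm, mul_sum]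
  refine sum_le_sum fun m' _ => ?_
  set P := PhiLace d (N - 1) ν m' (collapseVec hN t) (fun j => if j = 0 then 0 else x (j + 1))
  have hP : 0 ≤ P := PhiLace_nonneg d (N - 1) hν.le m' ht' _
  calc _ ≤ ∑ m ∈ laceFinset (2 * N - 1) n r with collapseVec hN m = m',
        (P * K ^ 2) * ((g (m ⟨0, by omega⟩) + g (m ⟨3, by omega⟩)) *
          (g (m ⟨1, by omega⟩) + g (m ⟨4, by omega⟩))) := by
        refine sum_le_sum fun m hm => ?_
        obtain ⟨hm, hmm⟩ := mem_filter.1 hm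
        refine (integral_PhiLace_le hN hν hc ht hrt (mem_laceFinset.1 hm).2 hx).trans_eq ?_
        rw [hmm]
        ring
    _ ≤ (P * K ^ 2) * (2 * ∑' i, g i) ^ 2 := by
        rw [← mul_sum]
        exact mul_le_mul_of_nonneg_left (sum_fiber_le hN hg (fun i => (hg0 i).le) _ m')
          (by positivity)
    _ = K ^ 2 * (2 * ∑' i, g i) ^ 2 * P := by ring
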